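/- Let K be a field of characteristic zero and let (A1, A2) be an r×n Pfaffian pair over K with column set E. For a vector z = (z_j)_{j∈E} over K, let Ξ(z) be the (r + n)×(r + n) block matrix, with rows and columns indexed by Fin r ⊕ E, given by Ξ(z) = [[O, A1], [A2ᵀ, D(z)]]. For J ⊆ E, let φ_J(1) be the vector with entry 0 at every j ∈ J and entry 1 at every j ∈ E \ J. Then J is extensible — i.e., there exists a common base B of (A1, A2) with J ⊆ B — if and only if Ξ(φ_J(1)) is nonsingular. -/

import Mathlib

open Matrix

/-- The square submatrix of `A` formed by the columns in `B` taken in increasing order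
(junk value `0` if `B.card ≠ r`). -/
noncomputable def colSub {R : Type*} [CommRing R] {r : ℕ} {E : Type*} [Fintype E] [LinearOrder E]
    (A : Matrix (Fin r) E R) (B : Finset E) : Matrix (Fin r) (Fin r) R :=
  if h : B.card = r then A.submatrix id (fun i => B.orderEmbOfFin h i) else 0

/-- The block matrix `Ξ(z) = [[O, A1], [A2ᵀ, D(z)]]`, with rows and columns indexed by
`Fin r ⊕ E`. -/
def XiMat {K : Type*} [CommRing K] {r : ℕ} {E : Type*} [Fintype E] [DecidableEq E]
    (A1 A2 : Matrix (Fin r) E K) (z : E → K) : Matrix (Fin r ⊕ E) (Fin r ⊕ E) K :=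
  Matrix.fromBlocks 0 A1 A2ᵀ (Matrix.diagonal z)

/-- Auxiliary term of the row expansion. -/
def auxM {K : Type*} [CommRing K] {r : ℕ} {E : Type*} [Fintype E] [DecidableEq E]
    (A1 A2 : Matrix (Fin r) E K) (z : E → K) (S : Finset E) :
    Matrix (Fin r ⊕ E) (Fin r ⊕ E) K :=
  Matrix.fromBlocks 0 A1 (Matrix.of fun i j => if i ∈ S then A2 j i else 0)
    (Matrix.diagonal fun i => if i ∈ S then 0 else z i)

lemma det_Xi_expand {K : Type*} [CommRing K] {r : ℕ} {E : Type*} [Fintype E] [DecidableEq E]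
    (A1 A2 : Matrix (Fin r) E K) (z : E → K) :
    (XiMat A1 A2 z).det = ∑ S : Finset E, (auxM A1 A2 z S).det := by
  have h := ((Matrix.detRowAlternating (R := K) (n := Fin r ⊕ E)).toMultilinearMap.currySum
    (fun i => Sum.elim 0 (A1 i))).map_add_univ (fun i => Sum.elim (fun j => A2 j i) 0)
    (fun i => Sum.elim 0 (Matrix.diagonal z i))
  simp only [MultilinearMap.currySum_apply] at h
  convert h using 1
  · change Matrix.det _ = Matrix.det _
    congr 1
    ext (i | i) (j | j) <;> simp [XiMat]
  · refine Finset.sum_congr rfl fun S _ => ?_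
    change Matrix.det _ = Matrix.det _
    congr 1
    ext (i | i) j
    · rcases j with j | j <;> simp [auxM]
    · rcases j with j | j <;> by_cases hi : i ∈ S <;>
        simp [auxM, Finset.piecewise, hi, Matrix.diagonal_apply]

lemma det_auxM_eq_zero {K : Type*} [CommRing K] {r : ℕ} {E : Type*} [Fintype E] [DecidableEq E]
    (A1 A2 : Matrix (Fin r) E K) (z : E → K) (S : Finset E) (hS : S.card ≠ r) :
    (auxM A1 A2 z S).det = 0 := by
  rw [Matrix.det_apply]
  refine Finset.sum_eq_zero fun σ _ => ?_
  suffices h : ∏ i, auxM A1 A2 z S (σ i) i = 0 by rw [h, smul_zero]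
  by_contra hne
  have hn : ∀ i, auxM A1 A2 z S (σ i) i ≠ 0 := fun i h0 =>
    hne (Finset.prod_eq_zero (Finset.mem_univ i) h0)
  apply hS
  have : (Finset.univ.map Function.Embedding.inl : Finset (Fin r ⊕ E)).map σ.toEmbedding
      = S.map Function.Embedding.inr := by
    ext x
    obtain ⟨y, rfl⟩ := σ.surjective x
    have := hn y
    rcases y with y | y
    · rcases h : σ (Sum.inl y) with w | w
      · rw [h] at this
        simp [auxM] at this
      · rw [h] at this
        simp [auxM] at this
        simp only [← h, Finset.mem_map_equiv, Equiv.symm_apply_apply]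
        simp [h, this.1]
    · rcases h : σ (Sum.inr y) with w | w
      · simp only [← h, Finset.mem_map_equiv, Equiv.symm_apply_apply]
        simp [h]
      · rw [h] at this
        simp [auxM, Matrix.diagonal_apply] at this
        simp only [← h, Finset.mem_map_equiv, Equiv.symm_apply_apply]
        simp [h, this.2.1]
  have := congrArg Finset.card this
  simpa using this.symm

/-- The sign. -/
def auxEps (K : Type*) [CommRing K] (r : ℕ) : K :=
  (Matrix.fromBlocks 0 1 1 0 : Matrix (Fin r ⊕ Fin r) (Fin r ⊕ Fin r) K).det

lemma auxEps_ne_zero (K : Type*) [Field K] (r : ℕ) : auxEps K r ≠ 0 := by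
  have : auxEps K r * auxEps K r = 1 := by
    rw [auxEps, ← Matrix.det_mul, Matrix.fromBlocks_multiply]
    simp
  intro h
  simp [h] at this

lemma det_auxM_eq {K : Type*} [CommRing K] {r : ℕ} {E : Type*} [Fintype E] [LinearOrder E]
    (A1 A2 : Matrix (Fin r) E K) (z : E → K) (S : Finset E) (hS : S.card = r) :
    (auxM A1 A2 z S).det =
      auxEps K r * ((colSub A1 S).det * (colSub A2 S).det) * ∏ i : {i // i ∉ S}, z i := by
  let f : (Fin r ⊕ Fin r) ⊕ {i // i ∉ S} → Fin r ⊕ E :=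
    Sum.elim (Sum.elim Sum.inl (fun i => Sum.inr (S.orderEmbOfFin hS i))) (fun i => Sum.inr i.1)
  have hf : Function.Bijective f := by
    constructor
    · rintro ((i | i) | ⟨i, hi⟩) ((j | j) | ⟨j, hj⟩) h <;> simp [f] at h ⊢
      · exact h
      · exact h
      · exact hj (h ▸ S.orderEmbOfFin_mem hS i)
      · exact hi (h ▸ S.orderEmbOfFin_mem hS j)
      · exact h
    · rintro (i | i)
      · exact ⟨.inl (.inl i), rfl⟩
      · by_cases hi : i ∈ S
        · have : i ∈ Set.range (S.orderEmbOfFin hS) := by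
            rw [Finset.range_orderEmbOfFin]; exact hi
          obtain ⟨k, rfl⟩ := this
          exact ⟨.inl (.inr k), rfl⟩
        · exact ⟨.inr ⟨i, hi⟩, rfl⟩
  let e := Equiv.ofBijective f hf
  rw [← Matrix.det_submatrix_equiv_self e]
  have h1 : (auxM A1 A2 z S).submatrix e e =
      Matrix.fromBlocks (Matrix.fromBlocks 0 (colSub A1 S) (colSub A2 S)ᵀ 0)
        (Matrix.of (Sum.elim (fun i j => A1 i j.1) 0)) 0
        (Matrix.diagonal fun i : {i // i ∉ S} => z i) := by
    ext ((i | i) | ⟨i, hi⟩) ((j | j) | ⟨j, hj⟩)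
    · simp [e, f, auxM]
    · simp [e, f, auxM, colSub, hS]
    · simp [e, f, auxM]
    · simp [e, f, auxM, colSub, hS]
    · simp [e, f, auxM, Matrix.diagonal_apply]
    · have : S.orderEmbOfFin hS i ≠ j := fun h => hj (h ▸ S.orderEmbOfFin_mem hS i)
      simp [e, f, auxM, Matrix.diagonal_apply]
    · simp [e, f, auxM, hi]
    · have : i ≠ S.orderEmbOfFin hS j := fun h => hi (h ▸ S.orderEmbOfFin_mem hS j)
      simp [e, f, auxM, Matrix.diagonal_apply, this]
    · simp [e, f, auxM, Matrix.diagonal_apply, hi]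
  have h2 : (Matrix.fromBlocks 0 (colSub A1 S) (colSub A2 S)ᵀ 0) =
      Matrix.fromBlocks (colSub A1 S) 0 0 (colSub A2 S)ᵀ * Matrix.fromBlocks 0 1 1 0 := by
    rw [Matrix.fromBlocks_multiply]; simp
  rw [h1, Matrix.det_fromBlocks_zero₂₁, h2, Matrix.det_mul, Matrix.det_fromBlocks_zero₂₁,
    Matrix.det_transpose, Matrix.det_diagonal, ← auxEps]
  ring

/-- For a Pfaffian pair `(A1, A2)` over a field of characteristic zero, a subset `J ⊆ E` is
extensible (contained in some common base) if and only if `Ξ(φ_J(1))` is nonsingular, where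
`φ_J(1)` is the vector that is `0` on `J` and `1` off `J`. -/
theorem extensible_iff_Xi_nonsingular {K : Type*} [Field K] [CharZero K] {r : ℕ}
    {E : Type*} [Fintype E] [LinearOrder E] (A1 A2 : Matrix (Fin r) E K)
    (c : K) (hc : c ≠ 0)
    (hPf : ∀ B : Finset E, B.card = r → (colSub A1 B).det ≠ 0 → (colSub A2 B).det ≠ 0 →
      (colSub A1 B).det * (colSub A2 B).det = c) :
    ∀ J : Finset E,
      ((∃ B : Finset E, B.card = r ∧ (colSub A1 B).det ≠ 0 ∧ (colSub A2 B).det ≠ 0 ∧ J ⊆ B)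
        ↔ (XiMat A1 A2 (fun j => if j ∈ J then (0 : K) else 1)).det ≠ 0) := by
  classical
  intro J
  have key : (XiMat A1 A2 (fun j => if j ∈ J then (0 : K) else 1)).det =
      auxEps K r * c * ((Finset.univ.filter fun B : Finset E => B.card = r ∧
        (colSub A1 B).det ≠ 0 ∧ (colSub A2 B).det ≠ 0 ∧ J ⊆ B).card : K) := by
    rw [det_Xi_expand, Finset.card_filter, Nat.cast_sum, Finset.mul_sum]
    refine Finset.sum_congr rfl fun S _ => ?_
    by_cases hS : S.card = r
    swap
    · rw [det_auxM_eq_zero _ _ _ _ hS]; simp [hS]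
    rw [det_auxM_eq _ _ _ _ hS]
    by_cases h1 : (colSub A1 S).det = 0
    · simp [h1]
    by_cases h2 : (colSub A2 S).det = 0
    · simp [h2]
    rw [hPf S hS h1 h2]
    by_cases hJ : J ⊆ S
    · rw [Finset.prod_eq_one]
      · simp [hS, h1, h2, hJ]
      · rintro ⟨i, hi⟩ _
        exact if_neg fun h => hi (hJ h)
    · obtain ⟨j, hj, hjS⟩ := Finset.not_subset.1 hJ
      rw [Finset.prod_eq_zero (Finset.mem_univ (⟨j, hjS⟩ : {i // i ∉ S})) (by simp [hj])]
      simp [hJ]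
  rw [key]
  simp only [ne_eq, mul_eq_zero, auxEps_ne_zero, hc, Nat.cast_eq_zero, Finset.card_eq_zero,
    false_or, ← Finset.nonempty_iff_ne_empty]
  simp [Finset.Nonempty]
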